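/- Completeness of XP⁻ for XPath↓⁻: (1) for all node expressions φ,ψ of XPath↓⁻, XP⁻⊢φ≡ψ if and only if ⊨φ≡ψ; (2) for all path expressions α,β of XPath↓⁻, XP⁻⊢α≡β if and only if ⊨α≡β. -/

import Mathlib

attribute [local instance] Classical.propDecidable

mutual
/-- Path expressions of `XPath↓⁻` (no inequality tests in the language). -/
inductive PathExpr (A : Type) : Type
  | eps : PathExpr A
  | down : PathExpr A
  | test : NodeExpr A → PathExpr A
  | comp : PathExpr A → PathExpr A → PathExpr A
  | union : PathExpr A → PathExpr A → PathExpr A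

/-- Node expressions of `XPath↓⁻` (no inequality tests in the language). -/
inductive NodeExpr (A : Type) : Type
  | lab : A → NodeExpr A
  | neg : NodeExpr A → NodeExpr A
  | conj : NodeExpr A → NodeExpr A → NodeExpr A
  | diam : PathExpr A → NodeExpr A
  | eqTest : PathExpr A → PathExpr A → NodeExpr A
end

namespace XPathMinus

variable {A : Type}

/-- Defined disjunction `φ ∨ ψ := ¬(¬φ ∧ ¬ψ)`. -/
def nOr (φ ψ : NodeExpr A) : NodeExpr A := .neg (.conj (.neg φ) (.neg ψ))

/-- `⊤ := ⟨ε⟩`. -/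
def topN : NodeExpr A := .diam .eps

/-- `⊥ := ¬⊤`. -/
def botN : NodeExpr A := .neg topN

/-- `⊥̄ := [¬⟨ε⟩]`. -/
def botP : PathExpr A := .test (.neg (.diam .eps))

def bigOr (l : List (NodeExpr A)) : NodeExpr A := l.foldr nOr botN

def bigUnion (l : List (PathExpr A)) : PathExpr A := l.foldr PathExpr.union botP

/-- A data tree: a tree (connected, acyclic, unique parents except the root)
whose nodes carry labels from `A`, together with a partition of the nodes
(presented as an equivalence relation `eqd`). -/
structure DataTree (A : Type) where
  X : Type
  child : X → X → Prop
  root : X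
  label : X → A
  eqd : X → X → Prop
  eqd_equiv : Equivalence eqd
  parent_unique : ∀ ⦃x y z : X⦄, child x z → child y z → x = y
  root_no_parent : ∀ x : X, ¬ child x root
  reach : ∀ x : X, Relation.ReflTransGen child root x
  acyclic : ∀ x : X, ¬ Relation.TransGen child x x

mutual
/-- Semantics of path expressions. -/
def psem (T : DataTree A) : PathExpr A → T.X → T.X → Prop
  | .eps, x, y => x = y
  | .down, x, y => T.child x y
  | .test φ, x, y => x = y ∧ nsem T φ x
  | .comp α β, x, z => ∃ y, psem T α x y ∧ psem T β y z
  | .union α β, x, y => psem T α x y ∨ psem T β x y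

/-- Semantics of node expressions. -/
def nsem (T : DataTree A) : NodeExpr A → T.X → Prop
  | .lab a, x => T.label x = a
  | .neg φ, x => ¬ nsem T φ x
  | .conj φ ψ, x => nsem T φ x ∧ nsem T ψ x
  | .diam α, x => ∃ y, psem T α x y
  | .eqTest α β, x => ∃ y z, psem T α x y ∧ psem T β x z ∧ T.eqd y z
end

/-- Semantic equivalence of node expressions: same denotation in every data tree. -/
def nodeValid (φ ψ : NodeExpr A) : Prop :=
  ∀ (T : DataTree A) (x : T.X), nsem T φ x ↔ nsem T ψ x

/-- Semantic equivalence of path expressions: same denotation in every data tree. -/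
def pathValid (α β : PathExpr A) : Prop :=
  ∀ (T : DataTree A) (x y : T.X), psem T α x y ↔ psem T β x y

mutual
/-- Derivability of node equivalences in the axiomatic system `XP⁻`. -/
inductive NDer {A : Type} [Fintype A] : NodeExpr A → NodeExpr A → Prop
  | refl (φ : NodeExpr A) : NDer φ φ
  | symm {φ ψ : NodeExpr A} : NDer φ ψ → NDer ψ φ
  | trans {φ ψ ρ : NodeExpr A} : NDer φ ψ → NDer ψ ρ → NDer φ ρ
  | congr_neg {φ ψ : NodeExpr A} : NDer φ ψ → NDer (.neg φ) (.neg ψ)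
  | congr_conj {φ φ' ψ ψ' : NodeExpr A} :
      NDer φ φ' → NDer ψ ψ' → NDer (.conj φ ψ) (.conj φ' ψ')
  | congr_diam {α β : PathExpr A} : PDer α β → NDer (.diam α) (.diam β)
  | congr_eqTest {α α' β β' : PathExpr A} :
      PDer α α' → PDer β β' → NDer (.eqTest α β) (.eqTest α' β')
  | lbAx1 : NDer topN (bigOr ((Finset.univ : Finset A).toList.map NodeExpr.lab))
  | lbAx2 {a b : A} : a ≠ b → NDer botN (.conj (.lab a) (.lab b))
  | ndAx1 (φ ψ : NodeExpr A) :
      NDer φ (nOr (.neg (nOr (.neg φ) ψ)) (.neg (nOr (.neg φ) (.neg ψ))))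
  | ndAx2 (φ : NodeExpr A) : NDer (.diam (.test φ)) φ
  | ndAx3 (α β : PathExpr A) : NDer (.diam (.union α β)) (nOr (.diam α) (.diam β))
  | ndAx4 (α β : PathExpr A) : NDer (.diam (.comp α β)) (.diam (.comp α (.test (.diam β))))
  | eqAx1 (α β : PathExpr A) : NDer (.eqTest α β) (.eqTest β α)
  | eqAx2 (α β γ : PathExpr A) :
      NDer (.eqTest (.union α β) γ) (nOr (.eqTest α γ) (.eqTest β γ))
  | eqAx3 (φ : NodeExpr A) (α β : PathExpr A) :
      NDer (.conj φ (.eqTest α β)) (.eqTest (.comp (.test φ) α) β)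
  | eqAx4 (α β : PathExpr A) : NDer (nOr (.eqTest α β) (.diam α)) (.diam α)
  | eqAx5 (γ α β : PathExpr A) :
      NDer (nOr (.diam (.comp γ (.test (.eqTest α β)))) (.eqTest (.comp γ α) (.comp γ β)))
        (.eqTest (.comp γ α) (.comp γ β))
  | eqAx6 (α : PathExpr A) : NDer (.eqTest α α) (.diam α)
  | eqAx7 (α β : PathExpr A) :
      NDer (nOr (.conj (.eqTest α .eps) (.eqTest β .eps)) (.eqTest α β)) (.eqTest α β)
  | eqAx8 (α β γ : PathExpr A) :
      NDer (nOr (.eqTest α (.comp β (.test (.eqTest .eps γ)))) (.eqTest α (.comp β γ)))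
        (.eqTest α (.comp β γ))

/-- Derivability of path equivalences in the axiomatic system `XP⁻`. -/
inductive PDer {A : Type} [Fintype A] : PathExpr A → PathExpr A → Prop
  | refl (α : PathExpr A) : PDer α α
  | symm {α β : PathExpr A} : PDer α β → PDer β α
  | trans {α β γ : PathExpr A} : PDer α β → PDer β γ → PDer α γ
  | congr_test {φ ψ : NodeExpr A} : NDer φ ψ → PDer (.test φ) (.test ψ)
  | congr_comp {α α' β β' : PathExpr A} :
      PDer α α' → PDer β β' → PDer (.comp α β) (.comp α' β')
  | congr_union {α α' β β' : PathExpr A} :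
      PDer α α' → PDer β β' → PDer (.union α β) (.union α' β')
  | prAx1 (α β : PathExpr A) : PDer (.comp (.comp α (.test (.neg (.diam β)))) β) botP
  | prAx2 : PDer (.test topN) (.eps : PathExpr A)
  | prAx3 (φ ψ : NodeExpr A) : PDer (.test (nOr φ ψ)) (.union (.test φ) (.test ψ))
  | isAx1 (α β γ : PathExpr A) : PDer (.union (.union α β) γ) (.union α (.union β γ))
  | isAx2 (α β : PathExpr A) : PDer (.union α β) (.union β α)
  | isAx3 (α : PathExpr A) : PDer (.union α α) α
  | isAx4 (α β γ : PathExpr A) : PDer (.comp α (.comp β γ)) (.comp (.comp α β) γ)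
  | isAx5l (α : PathExpr A) : PDer (.comp .eps α) α
  | isAx5r (α : PathExpr A) : PDer (.comp α .eps) α
  | isAx6l (α β γ : PathExpr A) :
      PDer (.comp α (.union β γ)) (.union (.comp α β) (.comp α γ))
  | isAx6r (α β γ : PathExpr A) :
      PDer (.comp (.union α β) γ) (.union (.comp α γ) (.comp β γ))
  | isAx7 (α : PathExpr A) : PDer (.union botP α) α
end

/-- A node expression is `XP⁻`-consistent if it is not provably equivalent to `⊥`. -/
def NConsistent [Fintype A] (φ : NodeExpr A) : Prop := ¬ NDer φ botN

/-- A path expression is `XP⁻`-consistent if it is not provably equivalent to `⊥̄`. -/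
def PConsistent [Fintype A] (α : PathExpr A) : Prop := ¬ PDer α botP

/-- The normal form `a ∧ ⋀_{d ∈ C} d ∧ ⋀_{d ∈ D∖C} ¬d`, built along the canonical listing `D`. -/
noncomputable def mkNF (a : A) (C D : List (NodeExpr A)) : NodeExpr A :=
  D.foldl (fun acc d => .conj acc (if d ∈ C then d else .neg d)) (.lab a)

/-- The canonical lists of normal-form path expressions (first component)
and normal-form node expressions (second component) at each level. -/
noncomputable def NF (A : Type) [Fintype A] : ℕ → List (PathExpr A) × List (NodeExpr A)
  | 0 =>
    ([.eps],
      (Finset.univ : Finset A).toList.map fun a =>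
        NodeExpr.conj (.lab a) (.eqTest .eps .eps))
  | n+1 =>
    let P := (NF A n).1
    let N := (NF A n).2
    let P' : List (PathExpr A) :=
      .eps :: N.flatMap fun ψ => P.map fun β => PathExpr.comp .down (.comp (.test ψ) β)
    let D : List (NodeExpr A) :=
      P'.flatMap fun α => P'.map fun β => NodeExpr.eqTest α β
    let cands : List (NodeExpr A) :=
      D.sublists.flatMap fun C => (Finset.univ : Finset A).toList.map fun a => mkNF a C D
    (P', cands.filter fun φ => decide (NConsistent φ))

/-- `P̂ₙ`: normal-form path expressions of level `n`. -/
noncomputable def Pnf (A : Type) [Fintype A] (n : ℕ) : Set (PathExpr A) :=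
  {α | α ∈ (NF A n).1}

/-- `N̂ₙ`: normal-form node expressions of level `n`. -/
noncomputable def Nnf (A : Type) [Fintype A] (n : ℕ) : Set (NodeExpr A) :=
  {φ | φ ∈ (NF A n).2}

/-- `D̂ₙ`: data-aware diamonds between normal-form paths of level `n`. -/
noncomputable def Dnf (A : Type) [Fintype A] (n : ℕ) : Set (NodeExpr A) :=
  {φ | ∃ α ∈ Pnf A n, ∃ β ∈ Pnf A n, φ = NodeExpr.eqTest α β}

/-- The conjuncts of a node expression (flattening `∧`). -/
def conjuncts : NodeExpr A → List (NodeExpr A)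
  | .conj φ ψ => conjuncts φ ++ conjuncts ψ
  | φ => [φ]

/-- `δ` is a conjunct of `ψ`. -/
def IsConjunct (δ ψ : NodeExpr A) : Prop := δ ∈ conjuncts ψ

/-- Length of a path expression. -/
def plen : PathExpr A → ℕ
  | .eps => 0
  | .down => 1
  | .test _ => 0
  | .comp α β => plen α + plen β
  | .union α β => max (plen α) (plen β)

mutual
/-- Downward depth of a node expression. -/
def ndd : NodeExpr A → ℕ
  | .lab _ => 0
  | .neg φ => ndd φ
  | .conj φ ψ => max (ndd φ) (ndd ψ)
  | .diam α => pdd α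
  | .eqTest α β => max (pdd α) (pdd β)

/-- Downward depth of a path expression. -/
def pdd : PathExpr A → ℕ
  | .eps => 0
  | .down => 1
  | .test φ => ndd φ
  | .comp α β => max (max (pdd α) (pdd β)) (plen α + pdd β)
  | .union α β => max (pdd α) (pdd β)
end

/-- The path `↓[ψ]α`. -/
def dPath (ψ : NodeExpr A) (α : PathExpr A) : PathExpr A :=
  .comp .down (.comp (.test ψ) α)

/-- A path expression whose leftmost symbol is `↓`. -/
def startsWithDown : PathExpr A → Prop
  | .down => True
  | .comp α _ => startsWithDown α
  | _ => False

end XPathMinus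

namespace XPathMinus

section Soundness

theorem nsem_nOr (T : DataTree A) (φ ψ : NodeExpr A) (x : T.X) :
    nsem T (nOr φ ψ) x ↔ nsem T φ x ∨ nsem T ψ x := by
  simp only [nOr, nsem]; tauto

theorem nsem_bigOr (T : DataTree A) (l : List (NodeExpr A)) (x : T.X) :
    nsem T (bigOr l) x ↔ ∃ φ ∈ l, nsem T φ x := by
  induction l with
  | nil => simp [bigOr, botN, topN, nsem, psem]
  | cons φ l ih =>
    have : bigOr (φ :: l) = nOr φ (bigOr l) := rfl
    rw [this, nsem_nOr, ih]; simp

variable [Fintype A]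

mutual
theorem nsound : ∀ {φ ψ : NodeExpr A}, NDer φ ψ → nodeValid φ ψ
  | _, _, .refl _ => by
    intro T x
    rfl
  | _, _, .symm h => by
    intro T x
    exact (nsound h T x).symm
  | _, _, .trans h h' => by
    intro T x
    exact (nsound h T x).trans (nsound h' T x)
  | _, _, .congr_neg h => by
    intro T x
    simp only [nsem]; rw [nsound h T x]
  | _, _, .congr_conj h h' => by
    intro T x
    simp only [nsem]; rw [nsound h T x, nsound h' T x]
  | _, _, .congr_diam h => by
    intro T x
    simp only [nsem]; exact exists_congr fun y => psound h T x y
  | _, _, .congr_eqTest h h' => by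
    intro T x
    simp only [nsem]
    exact exists_congr fun y => exists_congr fun z =>
      and_congr (psound h T x y) (and_congr (psound h' T x z) Iff.rfl)
  | _, _, .lbAx1 => by
    intro T x
    rw [nsem_bigOr]; simp [topN, nsem, psem]
  | _, _, .lbAx2 h => by
    intro T x
    simp only [botN, topN, nsem, psem]
    constructor
    · intro h; exact absurd ⟨x, rfl⟩ h
    · rintro ⟨h1, h2⟩; exact absurd (h1.symm.trans h2) h
  | _, _, .ndAx1 φ ψ => by
    intro T x
    simp only [nsem_nOr, nsem]; tauto
  | _, _, .ndAx2 φ => by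
    intro T x
    simp [nsem, psem]
  | _, _, .ndAx3 α β => by
    intro T x
    simp only [nsem_nOr, nsem, psem, exists_or]
  | _, _, .ndAx4 α β => by
    intro T x
    simp only [nsem, psem]
    constructor
    · rintro ⟨z, y, h1, h2⟩; exact ⟨y, y, h1, rfl, z, h2⟩
    · rintro ⟨z, y, h1, rfl, w, h2⟩; exact ⟨w, y, h1, h2⟩
  | _, _, .eqAx1 α β => by
    intro T x
    simp only [nsem]
    constructor <;> rintro ⟨y, z, h1, h2, h3⟩ <;> exact ⟨z, y, h2, h1, T.eqd_equiv.symm h3⟩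
  | _, _, .eqAx2 α β γ => by
    intro T x
    simp only [nsem_nOr, nsem, psem]
    constructor
    · rintro ⟨y, z, h1 | h1, h2, h3⟩
      · exact Or.inl ⟨y, z, h1, h2, h3⟩
      · exact Or.inr ⟨y, z, h1, h2, h3⟩
    · rintro (⟨y, z, h1, h2, h3⟩ | ⟨y, z, h1, h2, h3⟩)
      · exact ⟨y, z, Or.inl h1, h2, h3⟩
      · exact ⟨y, z, Or.inr h1, h2, h3⟩
  | _, _, .eqAx3 φ α β => by
    intro T x
    simp only [nsem, psem]
    constructor
    · rintro ⟨h0, y, z, h1, h2, h3⟩; exact ⟨y, z, ⟨x, ⟨rfl, h0⟩, h1⟩, h2, h3⟩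
    · rintro ⟨y, z, ⟨_, ⟨rfl, h0⟩, h1⟩, h2, h3⟩; exact ⟨h0, y, z, h1, h2, h3⟩
  | _, _, .eqAx4 α β => by
    intro T x
    simp only [nsem_nOr, nsem, or_iff_right_iff_imp]
    rintro ⟨y, z, h1, h2, h3⟩; exact ⟨y, h1⟩
  | _, _, .eqAx5 γ α β => by
    intro T x
    simp only [nsem_nOr, nsem, psem, or_iff_right_iff_imp]
    rintro ⟨u, _, h1, rfl, y, z, h2, h3, h4⟩
    exact ⟨y, z, ⟨_, h1, h2⟩, ⟨_, h1, h3⟩, h4⟩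
  | _, _, .eqAx6 α => by
    intro T x
    simp only [nsem]
    constructor
    · rintro ⟨y, z, h1, h2, h3⟩; exact ⟨y, h1⟩
    · rintro ⟨y, h1⟩; exact ⟨y, y, h1, h1, T.eqd_equiv.refl y⟩
  | _, _, .eqAx7 α β => by
    intro T x
    simp only [nsem_nOr, nsem, psem, or_iff_right_iff_imp]
    rintro ⟨⟨y, _, h1, rfl, h2⟩, z, _, h3, rfl, h4⟩
    exact ⟨y, z, h1, h3, T.eqd_equiv.trans h2 (T.eqd_equiv.symm h4)⟩
  | _, _, .eqAx8 α β γ => by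
    intro T x
    simp only [nsem_nOr, nsem, psem, or_iff_right_iff_imp]
    rintro ⟨y, z, h1, ⟨u, h2, rfl, _, w, rfl, h3, h4⟩, h5⟩
    exact ⟨y, w, h1, ⟨_, h2, h3⟩, T.eqd_equiv.trans h5 h4⟩

theorem psound : ∀ {α β : PathExpr A}, PDer α β → pathValid α β
  | _, _, .refl _ => by
    intro T x y
    rfl
  | _, _, .symm h => by
    intro T x y
    exact (psound h T x y).symm
  | _, _, .trans h h' => by
    intro T x y
    exact (psound h T x y).trans (psound h' T x y)
  | _, _, .congr_test h => by
    intro T x y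
    simp only [psem]; rw [nsound h T x]
  | _, _, .congr_comp h h' => by
    intro T x y
    simp only [psem]; exact exists_congr fun z => and_congr (psound h T x z) (psound h' T z y)
  | _, _, .congr_union h h' => by
    intro T x y
    simp only [psem]; rw [psound h T x y, psound h' T x y]
  | _, _, .prAx1 α β => by
    intro T x y
    simp only [psem, nsem, botP]
    constructor
    · rintro ⟨u, ⟨_, h1, rfl, h2⟩, h3⟩; exact absurd ⟨y, h3⟩ h2
    · rintro ⟨_, h⟩; exact absurd ⟨x, rfl⟩ h
  | _, _, .prAx2 => by
    intro T x y
    simp [topN, psem, nsem]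
  | _, _, .prAx3 φ ψ => by
    intro T x y
    simp only [psem, nsem_nOr]; tauto
  | _, _, .isAx1 α β γ => by
    intro T x y
    simp only [psem]; tauto
  | _, _, .isAx2 α β => by
    intro T x y
    simp only [psem]; tauto
  | _, _, .isAx3 α => by
    intro T x y
    simp only [psem]; tauto
  | _, _, .isAx4 α β γ => by
    intro T x y
    simp only [psem]
    constructor
    · rintro ⟨u, h1, v, h2, h3⟩; exact ⟨v, ⟨u, h1, h2⟩, h3⟩
    · rintro ⟨v, ⟨u, h1, h2⟩, h3⟩; exact ⟨u, h1, v, h2, h3⟩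
  | _, _, .isAx5l α => by
    intro T x y
    simp [psem]
  | _, _, .isAx5r α => by
    intro T x y
    simp [psem]
  | _, _, .isAx6l α β γ => by
    intro T x y
    simp only [psem, and_or_left, exists_or]
  | _, _, .isAx6r α β γ => by
    intro T x y
    simp only [psem, or_and_right, exists_or]
  | _, _, .isAx7 α => by
    intro T x y
    simp [psem, nsem, botP]
end

end Soundness

section Boole

/-- Huntington equation (with commutativity, associativity, idempotency and a unit)
gives a Boolean algebra. -/
def huntington {B : Type} (s : B → B → B) (n : B → B) (t : B)
    (hc : ∀ a b, s a b = s b a) (ha : ∀ a b c, s (s a b) c = s a (s b c))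
    (hi : ∀ a, s a a = a) (h0 : ∀ a, s (n t) a = a)
    (H : ∀ a b, a = s (n (s (n a) b)) (n (s (n a) (n b)))) : BooleanAlgebra B := by
  have hu : ∀ x y, s x (n x) = s y (n y) := by
    intro x y
    rw [H x (n y), H (n x) (n y)]
    conv_rhs => rw [H y (n x), H (n y) (n x)]
    rw [← H (n x) (n y), ← H x (n y), ← H (n y) (n x), ← H y (n x)]
    have e1 := H x (n y)
    have e2 := H (n x) (n y)
    have e3 := H y (n x)
    have e4 := H (n y) (n x)
    rw [hc (n y) (n x)] at e3
    rw [hc (n y) (n (n x))] at e3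
    rw [hc (n (n y)) (n x), hc (n (n y)) (n (n x))] at e4
    generalize n (s (n x) (n y)) = p1 at *
    generalize n (s (n x) (n (n y))) = p2 at *
    generalize n (s (n (n x)) (n y)) = p3 at *
    generalize n (s (n (n x)) (n (n y))) = p4 at *
    calc s x (n x) = s (s p1 p2) (s p3 p4) := by rw [← e1, ← e2]
      _ = s (s p1 p3) (s p2 p4) := by
        rw [ha, ha, ← ha p2, ← ha p3, hc p2 p3]
      _ = s y (n y) := by rw [← e3, ← e4]
  have ht : ∀ x, s x (n x) = t := fun x => by
    rw [hu x t, hc, h0]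
  have hnn : ∀ x, n (n x) = x := fun x => by
    have := H x x
    rw [hc (n x) x, ht, h0, hi] at this
    exact this.symm
  let m : B → B → B := fun a b => n (s (n a) (n b))
  have mdef : ∀ a b, m a b = n (s (n a) (n b)) := fun _ _ => rfl
  have mc : ∀ a b, m a b = m b a := fun a b => by rw [mdef, mdef, hc]
  have ma : ∀ a b c, m (m a b) c = m a (m b c) := fun a b c => by simp only [mdef, hnn, ha]
  have mi : ∀ a, m a a = a := fun a => by simp only [mdef, hnn, hi]
  have split : ∀ a b, a = s (m a b) (m a (n b)) := fun a b => by
    simp only [mdef, hnn]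
    rw [hc]; exact H a b
  have abs1 : ∀ a b, s a (m a b) = a := fun a b => by
    conv_lhs => rw [split a b]
    rw [← split a b]
    conv_lhs => enter [1]; rw [split a b]
    rw [hc, ← ha, hi, ← split]
  have abs2 : ∀ a b, m a (s a b) = a := fun a b => by
    have := abs1 (n a) (n b)
    rw [mdef, hnn, hnn] at this
    rw [mdef, this, hnn]
  letI : Max B := ⟨s⟩
  letI : Min B := ⟨m⟩
  letI L : Lattice B := Lattice.mk' hc ha mc ma abs1 abs2
  have hlt : ∀ a : B, a ≤ t := fun a => by
    have : a ≤ s a (n a) := le_sup_left (a := a) (b := n a)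
    rwa [ht] at this
  have hlb : ∀ a : B, n t ≤ a := fun a => by
    have : n t ≤ s (n t) a := le_sup_left (a := n t) (b := a)
    rwa [h0] at this
  have mn : ∀ a, m a (n a) = n t := fun a => by
    rw [mdef, hnn, hc, ht]
  have spl : ∀ a b c : B, a ⊓ b ≤ c → a ⊓ n b ≤ c → a ≤ c := fun a b c h1 h2 => by
    have := split a b
    calc a = (a ⊓ b) ⊔ (a ⊓ n b) := this
      _ ≤ c := sup_le h1 h2
  have dm : ∀ a b : B, n (a ⊔ b) = n a ⊓ n b := fun a b => by
    change n (s a b) = n (s (n (n a)) (n (n b)))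
    rw [hnn, hnn]
  have key : ∀ y z : B, (y ⊔ z) ⊓ n y ≤ z := fun y z => by
    apply spl _ z
    · exact inf_le_right
    · rw [inf_assoc, ← dm]
      exact (le_of_eq (mn (y ⊔ z))).trans (hlb _)
  letI D : DistribLattice B := DistribLattice.ofInfSupLe (fun x y z => by
    apply spl _ y
    · exact le_sup_of_le_left (le_inf (inf_le_left.trans inf_le_left) inf_le_right)
    · apply le_sup_of_le_right
      rw [inf_assoc]
      exact le_inf inf_le_left (inf_le_right.trans (key y z)))
  exact
    { D with
      compl := n
      top := t
      bot := n t
      le_top := hlt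
      bot_le := hlb
      inf_compl_le_bot := fun a => le_of_eq (mn a)
      top_le_sup_compl := fun a => le_of_eq (ht a).symm }

end Boole

end XPathMinus

namespace XPathMinus

section Lindenbaum
variable [Fintype A]

theorem toN {φ ψ : NodeExpr A} (h : PDer (.test φ) (.test ψ)) : NDer φ ψ :=
  ((NDer.ndAx2 φ).symm.trans (.congr_diam h)).trans (.ndAx2 ψ)

theorem nOr_congr {φ φ' ψ ψ' : NodeExpr A} (h : NDer φ φ') (h' : NDer ψ ψ') :
    NDer (nOr φ ψ) (nOr φ' ψ') :=
  .congr_neg (.congr_conj (.congr_neg h) (.congr_neg h'))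

theorem nOr_comm (φ ψ : NodeExpr A) : NDer (nOr φ ψ) (nOr ψ φ) :=
  toN (((PDer.prAx3 _ _).trans (.isAx2 _ _)).trans (PDer.prAx3 _ _).symm)

theorem nOr_assoc (φ ψ χ : NodeExpr A) : NDer (nOr (nOr φ ψ) χ) (nOr φ (nOr ψ χ)) := by
  apply toN
  refine (PDer.prAx3 _ _).trans ?_
  refine (PDer.congr_union (PDer.prAx3 _ _) (.refl _)).trans ?_
  refine (PDer.isAx1 _ _ _).trans ?_
  refine (PDer.congr_union (.refl _) (PDer.prAx3 _ _).symm).trans ?_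
  exact (PDer.prAx3 _ _).symm

theorem nOr_idem (φ : NodeExpr A) : NDer (nOr φ φ) φ :=
  toN ((PDer.prAx3 _ _).trans (.isAx3 _))

theorem nOr_bot (φ : NodeExpr A) : NDer (nOr botN φ) φ :=
  toN ((PDer.prAx3 _ _).trans (.isAx7 _))

/-- Provable equivalence as a setoid. -/
def nSetoid (A : Type) [Fintype A] : Setoid (NodeExpr A) :=
  ⟨NDer, fun φ => .refl φ, fun h => h.symm, fun h h' => h.trans h'⟩

def Lind (A : Type) [Fintype A] : Type := Quotient (nSetoid A)

/-- Class of a formula. -/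
def mkL (φ : NodeExpr A) : Lind A := Quotient.mk (nSetoid A) φ

theorem mkL_eq {φ ψ : NodeExpr A} : mkL φ = mkL ψ ↔ NDer φ ψ :=
  ⟨fun h => Quotient.exact (s := nSetoid A) h, fun h => Quotient.sound (s := nSetoid A) h⟩

/-- Join on the Lindenbaum algebra. -/
def supL : Lind A → Lind A → Lind A :=
  Quotient.map₂ nOr (fun _ _ h _ _ h' => nOr_congr h h')

def negL : Lind A → Lind A :=
  Quotient.map NodeExpr.neg (fun _ _ h => NDer.congr_neg h)

noncomputable instance instBA : BooleanAlgebra (Lind A) :=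
  huntington supL negL (mkL topN)
    (by rintro ⟨a⟩ ⟨b⟩; exact mkL_eq.2 (nOr_comm a b))
    (by rintro ⟨a⟩ ⟨b⟩ ⟨c⟩; exact mkL_eq.2 (nOr_assoc a b c))
    (by rintro ⟨a⟩; exact mkL_eq.2 (nOr_idem a))
    (by rintro ⟨a⟩; exact mkL_eq.2 (nOr_bot a))
    (by rintro ⟨a⟩ ⟨b⟩; exact mkL_eq.2 (NDer.ndAx1 a b))

theorem mkL_or (φ ψ : NodeExpr A) : mkL (nOr φ ψ) = mkL φ ⊔ mkL ψ := rfl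
theorem mkL_neg (φ : NodeExpr A) : mkL (.neg φ) = (mkL φ)ᶜ := rfl
theorem mkL_top : mkL (topN : NodeExpr A) = ⊤ := rfl
theorem mkL_bot : mkL (botN : NodeExpr A) = ⊥ := rfl

theorem neg_neg_der (φ : NodeExpr A) : NDer (.neg (.neg φ)) φ :=
  mkL_eq.1 (by rw [mkL_neg, mkL_neg, compl_compl])

theorem mkL_conj (φ ψ : NodeExpr A) : mkL (.conj φ ψ) = mkL φ ⊓ mkL ψ := by
  have h : mkL (.conj φ ψ) = mkL (.neg (nOr (.neg φ) (.neg ψ))) := by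
    refine mkL_eq.2 (((NDer.congr_conj (neg_neg_der φ) (neg_neg_der ψ)).symm).trans ?_)
    exact (neg_neg_der _).symm
  rw [h, mkL_neg, mkL_or, mkL_neg, mkL_neg, compl_sup, compl_compl, compl_compl]

theorem em_der (φ : NodeExpr A) : NDer (nOr φ (.neg φ)) topN :=
  mkL_eq.1 (by rw [mkL_or, mkL_neg, mkL_top, sup_compl_eq_top])

/-- Maximal consistent sets. -/
structure MCS (A : Type) [Fintype A] where
  car : NodeExpr A → Prop
  resp : ∀ {φ ψ}, NDer φ ψ → (car φ ↔ car ψ)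
  neg : ∀ φ, car (.neg φ) ↔ ¬ car φ
  conj : ∀ φ ψ, car (.conj φ ψ) ↔ car φ ∧ car ψ
  top : car topN

theorem MCS.or (M : MCS A) (φ ψ : NodeExpr A) : M.car (nOr φ ψ) ↔ M.car φ ∨ M.car ψ := by
  simp only [nOr, M.neg, M.conj]; tauto

theorem MCS.le (M : MCS A) {φ ψ : NodeExpr A} (h : NDer (nOr φ ψ) ψ) (h1 : M.car φ) :
    M.car ψ :=
  (M.resp h).1 ((M.or φ ψ).2 (Or.inl h1))

theorem exists_mcs (I : NodeExpr A → Prop)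
    (hresp : ∀ {φ ψ}, NDer φ ψ → I φ → I ψ)
    (hdown : ∀ {φ ψ}, I (nOr φ ψ) → I φ)
    (hor : ∀ {φ ψ}, I φ → I ψ → I (nOr φ ψ))
    (hbot : I botN) (htop : ¬ I topN) :
    ∃ M : MCS A, ∀ φ, M.car φ → ¬ I φ := by
  let J : Order.Ideal (Lind A) :=
    { carrier := {b | ∃ ψ, I ψ ∧ b = mkL ψ}
      lower' := by
        rintro a b hab ⟨ψ, h1, rfl⟩
        obtain ⟨φ, rfl⟩ : ∃ φ, mkL φ = b := Quotient.exists_rep b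
        have : mkL (nOr φ ψ) = mkL ψ := by rw [mkL_or]; exact sup_eq_right.2 hab
        exact ⟨φ, hdown (hresp (mkL_eq.1 this.symm) h1), rfl⟩
      nonempty' := ⟨mkL botN, botN, hbot, rfl⟩
      directed' := by
        rintro _ ⟨φ, h1, rfl⟩ _ ⟨ψ, h2, rfl⟩
        exact ⟨mkL (nOr φ ψ), ⟨_, hor h1 h2, rfl⟩, le_sup_left (a := mkL φ) (b := mkL ψ),
          le_sup_right (a := mkL φ) (b := mkL ψ)⟩ }
  have hJ : J.IsProper := by
    apply Order.Ideal.isProper_of_notMem (p := (⊤ : Lind A))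
    rintro ⟨ψ, h1, h2⟩
    exact htop (hresp (mkL_eq.1 h2.symm) h1)
  obtain ⟨K, hJK, hK⟩ := hJ.exists_le_maximal
  have hp : K.IsPrime := inferInstance
  have htopK : (⊤ : Lind A) ∉ K := Order.Ideal.IsProper.top_notMem hp.toIsProper
  refine ⟨⟨fun φ => mkL φ ∉ K, ?_, ?_, ?_, htopK⟩, ?_⟩
  · intro φ ψ h; rw [mkL_eq.2 h]
  · intro φ
    rw [mkL_neg, not_not]
    constructor
    · intro h; exact hp.mem_or_compl_mem.resolve_right h
    · intro h h'
      have := Order.Ideal.sup_mem h h'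
      rw [sup_compl_eq_top] at this
      exact htopK this
  · intro φ ψ
    rw [mkL_conj, ← not_or, not_iff_not]
    constructor
    · exact hp.mem_or_mem
    · rintro (h | h)
      · exact K.lower inf_le_left h
      · exact K.lower inf_le_right h
  · intro φ h h'
    exact h (hJK ⟨φ, h', rfl⟩)

end Lindenbaum
end XPathMinus

namespace XPathMinus

section Paths
variable [Fintype A]

/-- Provable inclusion of paths. -/
def PLe (α β : PathExpr A) : Prop := PDer (.union α β) β

theorem PLe.refl (α : PathExpr A) : PLe α α := PDer.isAx3 α

theorem PLe.of_eq {α β : PathExpr A} (h : PDer α β) : PLe α β :=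
  (PDer.congr_union h (.refl β)).trans (.isAx3 β)

theorem PLe.trans {α β γ : PathExpr A} (h : PLe α β) (h' : PLe β γ) : PLe α γ := by
  refine (PDer.congr_union (.refl α) h'.symm).trans ?_
  refine (PDer.isAx1 _ _ _).symm.trans ?_
  exact (PDer.congr_union h (.refl γ)).trans h'

theorem PLe.antisymm {α β : PathExpr A} (h : PLe α β) (h' : PLe β α) : PDer α β :=
  (PDer.symm h').trans ((PDer.isAx2 _ _).trans h)

theorem PLe.inl (α β : PathExpr A) : PLe α (.union α β) :=
  (PDer.isAx1 _ _ _).symm.trans (.congr_union (.isAx3 α) (.refl β))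

theorem PLe.inr (α β : PathExpr A) : PLe β (.union α β) :=
  (PLe.inl β α).trans (PLe.of_eq (.isAx2 _ _))

theorem PLe.union_le {α β γ : PathExpr A} (h : PLe α γ) (h' : PLe β γ) :
    PLe (.union α β) γ :=
  (PDer.isAx1 _ _ _).trans ((PDer.congr_union (.refl α) h').trans h)

theorem PLe.bot (α : PathExpr A) : PLe botP α := PDer.isAx7 α

theorem PLe.comp {α α' β β' : PathExpr A} (h : PLe α α') (h' : PLe β β') :
    PLe (.comp α β) (.comp α' β') := by
  have h1 : PLe (.comp α β) (.comp α' β) :=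
    (PDer.isAx6r _ _ _).symm.trans (.congr_comp h (.refl β))
  have h2 : PLe (.comp α' β) (.comp α' β') :=
    (PDer.isAx6l _ _ _).symm.trans (.congr_comp (.refl α') h')
  exact h1.trans h2

theorem test_em (φ : NodeExpr A) : PDer (.union (.test φ) (.test (.neg φ))) .eps :=
  ((PDer.prAx3 _ _).symm.trans (.congr_test (em_der φ))).trans .prAx2

theorem PLe.test_eps (φ : NodeExpr A) : PLe (.test φ) .eps :=
  (PLe.inl _ _).trans (PLe.of_eq (test_em φ))

theorem PLe.testL (φ : NodeExpr A) (α : PathExpr A) : PLe (.comp (.test φ) α) α :=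
  ((PLe.test_eps φ).comp (PLe.refl α)).trans (PLe.of_eq (.isAx5l α))

theorem PLe.testR (φ : NodeExpr A) (α : PathExpr A) : PLe (.comp α (.test φ)) α :=
  ((PLe.refl α).comp (PLe.test_eps φ)).trans (PLe.of_eq (.isAx5r α))

namespace MCS
variable (M : MCS A)

theorem diam_mono {α β : PathExpr A} (h : PLe α β) (h1 : M.car (.diam α)) : M.car (.diam β) :=
  M.le ((NDer.ndAx3 α β).symm.trans (.congr_diam h)) h1

theorem eq_symm {α β : PathExpr A} (h1 : M.car (.eqTest α β)) : M.car (.eqTest β α) :=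
  (M.resp (NDer.eqAx1 α β)).1 h1

theorem eq_monoL {α α' β : PathExpr A} (h : PLe α α') (h1 : M.car (.eqTest α β)) :
    M.car (.eqTest α' β) :=
  M.le ((NDer.eqAx2 α α' β).symm.trans (.congr_eqTest h (.refl β))) h1

theorem eq_mono {α α' β β' : PathExpr A} (h : PLe α α') (h' : PLe β β')
    (h1 : M.car (.eqTest α β)) : M.car (.eqTest α' β') :=
  M.eq_monoL h (M.eq_symm (M.eq_monoL h' (M.eq_symm h1)))

theorem diam_test (φ : NodeExpr A) : M.car (.diam (.test φ)) ↔ M.car φ := M.resp (.ndAx2 φ)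

theorem diam_comp_left {α β : PathExpr A} (h : M.car (.diam (.comp α β))) : M.car (.diam α) :=
  M.diam_mono (PLe.testR _ _) ((M.resp (.ndAx4 α β)).1 h)

theorem diam_eps : M.car (.diam .eps) := M.top

theorem not_bot : ¬ M.car (.diam botP) := by
  intro h
  have := (M.diam_test _).1 h
  exact (M.neg _).1 this M.diam_eps

theorem diam_guard_left {φ : NodeExpr A} {α : PathExpr A}
    (h : M.car (.diam (.comp (.test φ) α))) : M.car φ :=
  (M.diam_test φ).1 (M.diam_comp_left h)

theorem diam_guard {φ : NodeExpr A} {α : PathExpr A} (h : M.car φ) (h' : M.car (.diam α)) :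
    M.car (.diam (.comp (.test φ) α)) := by
  have e : PDer α (.union (.comp (.test φ) α) (.comp (.test (.neg φ)) α)) :=
    (((PDer.isAx5l α).symm).trans (.congr_comp (test_em φ).symm (.refl α))).trans (.isAx6r _ _ _)
  rcases (M.or _ _).1 ((M.resp ((NDer.congr_diam e).trans (.ndAx3 _ _))).1 h') with h1 | h1
  · exact h1
  · exact absurd h ((M.neg φ).1 (M.diam_guard_left h1))

end MCS

/-- Endpoint of a path of maximal consistent sets. -/
def lastM : MCS A → List (MCS A) → MCS A
  | Γ, [] => Γ
  | _, Δ :: l => lastM Δ l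

theorem lastM_append (Γ : MCS A) (l l' : List (MCS A)) :
    lastM Γ (l ++ l') = lastM (lastM Γ l) l' := by
  induction l generalizing Γ with
  | nil => rfl
  | cons Δ l ih => exact ih Δ

/-- Canonical accessibility. -/
def Acc1 (Γ Δ : MCS A) : Prop := ∀ φ, Δ.car φ → Γ.car (.diam (.comp .down (.test φ)))

/-- Chains for the canonical accessibility relation. -/
def Chn : MCS A → List (MCS A) → Prop
  | _, [] => True
  | Γ, Δ :: l => Acc1 Γ Δ ∧ Chn Δ l

theorem Chn.append {Γ : MCS A} {l l' : List (MCS A)} (h : Chn Γ l) (h' : Chn (lastM Γ l) l') :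
    Chn Γ (l ++ l') := by
  induction l generalizing Γ with
  | nil => exact h'
  | cons Δ l ih => exact ⟨h.1, ih h.2 h'⟩

def Real : PathExpr A → MCS A → List (MCS A) → Prop
  | .eps, _, l => l = []
  | .down, _, l => ∃ Δ, l = [Δ]
  | .test φ, Γ, l => l = [] ∧ Γ.car φ
  | .comp α β, Γ, l => ∃ l1 l2, l = l1 ++ l2 ∧ Real α Γ l1 ∧ Real β (lastM Γ l1) l2
  | .union α β, Γ, l => Real α Γ l ∨ Real β Γ l

theorem Real.factor : ∀ (β : PathExpr A) (Γ : MCS A) (q r : List (MCS A)), Real β Γ (q ++ r) →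
    ∃ β1 β2, Real β1 Γ q ∧ Real β2 (lastM Γ q) r ∧ PLe (.comp β1 β2) β
  | .eps, Γ, q, r, h => by
    simp only [Real, List.append_eq_nil_iff] at h
    obtain ⟨rfl, rfl⟩ := h
    exact ⟨.eps, .eps, rfl, rfl, PLe.of_eq (.isAx5l _)⟩
  | .test φ, Γ, q, r, h => by
    simp only [Real, List.append_eq_nil_iff] at h
    obtain ⟨⟨rfl, rfl⟩, h⟩ := h
    exact ⟨.test φ, .eps, ⟨rfl, h⟩, rfl, PLe.of_eq (.isAx5r _)⟩
  | .down, Γ, q, r, h => by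
    obtain ⟨Δ, h⟩ := h
    rcases List.append_eq_singleton_iff.1 h with ⟨rfl, rfl⟩ | ⟨rfl, rfl⟩
    · exact ⟨.eps, .down, rfl, ⟨Δ, rfl⟩, PLe.of_eq (.isAx5l _)⟩
    · exact ⟨.down, .eps, ⟨Δ, rfl⟩, rfl, PLe.of_eq (.isAx5r _)⟩
  | .union α β, Γ, q, r, h => by
    rcases h with h | h
    · obtain ⟨β1, β2, h1, h2, h3⟩ := Real.factor α Γ q r h
      exact ⟨β1, β2, h1, h2, h3.trans (PLe.inl _ _)⟩
    · obtain ⟨β1, β2, h1, h2, h3⟩ := Real.factor β Γ q r h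
      exact ⟨β1, β2, h1, h2, h3.trans (PLe.inr _ _)⟩
  | .comp α β, Γ, q, r, h => by
    obtain ⟨s, s', h, hs, hs'⟩ := h
    rcases List.append_eq_append_iff.1 h with ⟨t, rfl, rfl⟩ | ⟨t, rfl, rfl⟩
    · obtain ⟨α1, α2, h1, h2, h3⟩ := Real.factor α Γ q t hs
      refine ⟨α1, .comp α2 β, h1, ⟨t, s', rfl, h2, ?_⟩, ?_⟩
      · rwa [lastM_append] at hs'
      · exact (PLe.of_eq (.isAx4 _ _ _)).trans (h3.comp (PLe.refl _))
    · obtain ⟨β1, β2, h1, h2, h3⟩ := Real.factor β (lastM Γ s) t r hs'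
      refine ⟨.comp α β1, β2, ⟨s, t, rfl, hs, h1⟩, ?_, ?_⟩
      · rwa [lastM_append]
      · exact (PLe.of_eq (PDer.isAx4 _ _ _).symm).trans ((PLe.refl _).comp h3)

theorem Real.single : ∀ (α : PathExpr A) (Γ : MCS A), Real α Γ [] →
    ∃ φ, Γ.car φ ∧ PLe (.test φ) α
  | .eps, Γ, _ => ⟨topN, Γ.top, PLe.of_eq .prAx2⟩
  | .test φ, Γ, h => ⟨φ, h.2, PLe.refl _⟩
  | .down, Γ, h => by obtain ⟨Δ, h⟩ := h; cases h
  | .union α β, Γ, h => by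
    rcases h with h | h
    · obtain ⟨φ, h1, h2⟩ := Real.single α Γ h
      exact ⟨φ, h1, h2.trans (PLe.inl _ _)⟩
    · obtain ⟨φ, h1, h2⟩ := Real.single β Γ h
      exact ⟨φ, h1, h2.trans (PLe.inr _ _)⟩
  | .comp α β, Γ, h => by
    obtain ⟨s, s', h, hs, hs'⟩ := h
    obtain ⟨rfl, rfl⟩ := List.append_eq_nil_iff.1 h.symm
    obtain ⟨φ, h1, h2⟩ := Real.single α Γ hs
    obtain ⟨ψ, h3, h4⟩ := Real.single β Γ hs'
    refine ⟨.conj φ ψ, (Γ.conj _ _).2 ⟨h1, h3⟩, PLe.trans ?_ (h2.comp h4)⟩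
    have e1 : PDer (.test (.conj φ ψ)) (.comp (.test (.conj φ ψ)) (.test (.conj φ ψ)) :
        PathExpr A) := by
      refine PLe.antisymm ?_ (PLe.testL _ _)
      refine (PLe.of_eq ((PDer.isAx5r _).symm.trans
        ((PDer.congr_comp (.refl _) (test_em (.conj φ ψ)).symm).trans (.isAx6l _ _ _)))).trans ?_
      refine PLe.union_le (PLe.refl _) (PLe.trans ?_ (PLe.bot _))
      have := PDer.prAx1 .eps (.test (.neg (.conj φ ψ)))
      refine PLe.of_eq (PDer.trans ?_ this)
      refine PDer.congr_comp (PDer.symm ((PDer.isAx5l _).trans (.congr_test ?_))) (.refl _)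
      exact (NDer.congr_neg (.ndAx2 _)).trans (neg_neg_der _)
    refine (PLe.of_eq e1).trans (PLe.comp ?_ ?_)
    · have : NDer (nOr (.conj φ ψ) φ) φ := mkL_eq.1 (by rw [mkL_or, mkL_conj]; simp)
      exact (PDer.prAx3 _ _).symm.trans (.congr_test this)
    · have : NDer (nOr (.conj φ ψ) ψ) ψ := mkL_eq.1 (by rw [mkL_or, mkL_conj]; simp)
      exact (PDer.prAx3 _ _).symm.trans (.congr_test this)

theorem Real.pair : ∀ (α : PathExpr A) (Γ Δ : MCS A), Real α Γ [Δ] →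
    ∃ φ ψ, Γ.car φ ∧ Δ.car ψ ∧ PLe (.comp (.test φ) (.comp .down (.test ψ))) α
  | .eps, Γ, Δ, h => by cases h
  | .test φ, Γ, Δ, h => by cases h.1
  | .down, Γ, Δ, h => ⟨topN, topN, Γ.top, Δ.top, (PLe.testL _ _).trans (PLe.testR _ _)⟩
  | .union α β, Γ, Δ, h => by
    rcases h with h | h
    · obtain ⟨φ, ψ, h1, h2, h3⟩ := Real.pair α Γ Δ h
      exact ⟨φ, ψ, h1, h2, h3.trans (PLe.inl _ _)⟩
    · obtain ⟨φ, ψ, h1, h2, h3⟩ := Real.pair β Γ Δ h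
      exact ⟨φ, ψ, h1, h2, h3.trans (PLe.inr _ _)⟩
  | .comp α β, Γ, Δ, h => by
    obtain ⟨s, s', h, hs, hs'⟩ := h
    -- merge tests through the single-node lemma applied to compositions of tests
    have merge : ∀ (M : MCS A) (φ ψ : NodeExpr A), M.car φ → M.car ψ →
        ∃ χ, M.car χ ∧ PLe (.test χ) (.comp (.test φ) (.test ψ)) := fun M φ ψ h1 h2 =>
      Real.single _ M ⟨[], [], rfl, ⟨rfl, h1⟩, ⟨rfl, h2⟩⟩
    rcases List.append_eq_singleton_iff.1 h.symm with ⟨rfl, rfl⟩ | ⟨rfl, rfl⟩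
    · obtain ⟨φ0, h0, h0'⟩ := Real.single α Γ hs
      obtain ⟨φ, ψ, h1, h2, h3⟩ := Real.pair β Γ Δ hs'
      obtain ⟨χ, hχ, hχ'⟩ := merge Γ φ0 φ h0 h1
      refine ⟨χ, ψ, hχ, h2, (hχ'.comp (PLe.refl _)).trans ?_⟩
      exact (PLe.of_eq (PDer.isAx4 _ _ _).symm).trans (h0'.comp h3)
    · obtain ⟨φ0, h0, h0'⟩ := Real.single β Δ hs'
      obtain ⟨φ, ψ, h1, h2, h3⟩ := Real.pair α Γ Δ hs
      obtain ⟨χ, hχ, hχ'⟩ := merge Δ ψ φ0 h2 h0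
      refine ⟨φ, χ, h1, hχ,
        ((PLe.refl _).comp ((PLe.refl _).comp hχ')).trans (PLe.trans ?_ (h3.comp h0'))⟩
      refine PLe.of_eq (PDer.trans ?_ (PDer.isAx4 _ _ _))
      exact PDer.congr_comp (.refl _) (.isAx4 _ _ _)

theorem Real.refine : ∀ (p : List (MCS A)) (Γ : MCS A) (α β : PathExpr A), Real α Γ p →
    Real β Γ p → ∃ γ, Real γ Γ p ∧ PLe γ α ∧ PLe γ β
  | [], Γ, α, β, h, h' => by
    obtain ⟨φ, h1, h2⟩ := Real.single α Γ h
    obtain ⟨ψ, h3, h4⟩ := Real.single β Γ h'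
    exact ⟨.comp (.test φ) (.test ψ), ⟨[], [], rfl, ⟨rfl, h1⟩, rfl, h3⟩,
      (PLe.testR _ _).trans h2, (PLe.testL _ _).trans h4⟩
  | Δ :: p, Γ, α, β, h, h' => by
    obtain ⟨α1, α2, h1, h2, h3⟩ := Real.factor α Γ [Δ] p h
    obtain ⟨β1, β2, k1, k2, k3⟩ := Real.factor β Γ [Δ] p h'
    obtain ⟨γ, g1, g2, g3⟩ := Real.refine p Δ α2 β2 h2 k2
    obtain ⟨φ, ψ, a1, a2, a3⟩ := Real.pair α1 Γ Δ h1
    obtain ⟨φ', ψ', b1, b2, b3⟩ := Real.pair β1 Γ Δ k1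
    refine ⟨.comp (.comp (.comp (.test φ) (.test φ'))
      (.comp .down (.comp (.test ψ) (.test ψ')))) γ,
      ⟨[Δ], p, rfl, ⟨[], [Δ], rfl, ⟨[], [], rfl, ⟨rfl, a1⟩, rfl, b1⟩,
        [Δ], [], rfl, ⟨Δ, rfl⟩, [], [], rfl, ⟨rfl, a2⟩, rfl, b2⟩, g1⟩, ?_, ?_⟩
    · exact ((((PLe.testR _ _).comp ((PLe.refl _).comp (PLe.testR _ _))).trans a3).comp g2).trans h3
    · exact ((((PLe.testL _ _).comp ((PLe.refl _).comp (PLe.testL _ _))).trans b3).comp g3).trans k3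

/-- Two sequences may end in the same data class. -/
def EqM (Γ : MCS A) (p q : List (MCS A)) : Prop :=
  ∀ α β, Real α Γ p → Real β Γ q → Γ.car (.eqTest α β)

theorem EqM.symm {Γ : MCS A} {p q : List (MCS A)} (h : EqM Γ p q) : EqM Γ q p :=
  fun α β ha hb => Γ.eq_symm (h β α hb ha)

theorem EqM.nil (Γ : MCS A) : EqM Γ [] [] := by
  intro α β ha hb
  obtain ⟨γ, h1, h2, h3⟩ := Real.refine [] Γ α β ha hb
  obtain ⟨φ, h4, h5⟩ := Real.single γ Γ h1
  refine Γ.eq_mono h2 h3 ((Γ.resp (.eqAx6 γ)).2 (Γ.diam_mono h5 ((Γ.diam_test φ).2 h4)))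

theorem EqM.ax7 {Γ : MCS A} {p q : List (MCS A)} (h : EqM Γ [] p) (h' : EqM Γ [] q) :
    EqM Γ p q := fun α β ha hb =>
  Γ.le (.eqAx7 α β) ((Γ.conj _ _).2 ⟨h.symm α .eps ha rfl, h'.symm β .eps hb rfl⟩)

theorem EqM.appendR {Γ : MCS A} {p q s : List (MCS A)} (h : EqM Γ p q)
    (h' : EqM (lastM Γ q) [] s) : EqM Γ p (q ++ s) := by
  intro α β ha hb
  obtain ⟨β1, β2, h1, h2, h3⟩ := Real.factor β Γ q s hb
  refine Γ.eq_mono (PLe.refl α) h3 (Γ.le (.eqAx8 α β1 β2) (h _ _ ha ?_))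
  exact ⟨q, [], by simp, h1, rfl, h' .eps β2 rfl h2⟩

theorem EqM.append {Γ : MCS A} {p q s t : List (MCS A)} (h : EqM Γ p q)
    (hs : EqM (lastM Γ p) [] s) (ht : EqM (lastM Γ q) [] t) : EqM Γ (p ++ s) (q ++ t) :=
  (((h.appendR ht).symm).appendR hs).symm

theorem EqM.lift {Γ Δ : MCS A} {p q : List (MCS A)} (hR : Acc1 Γ Δ) (h : EqM Δ p q) :
    EqM Γ (Δ :: p) (Δ :: q) := by
  intro α β ha hb
  obtain ⟨α1, α2, h1, h2, h3⟩ := Real.factor α Γ [Δ] p ha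
  obtain ⟨β1, β2, k1, k2, k3⟩ := Real.factor β Γ [Δ] q hb
  obtain ⟨γ, g1, g2, g3⟩ := Real.refine [Δ] Γ α1 β1 h1 k1
  refine Γ.eq_mono ((g2.comp (PLe.refl _)).trans h3) ((g3.comp (PLe.refl _)).trans k3)
    (Γ.le (.eqAx5 γ α2 β2) ?_)
  have e : Δ.car (.eqTest α2 β2) := h _ _ h2 k2
  have : Real (.comp γ (.test (.eqTest α2 β2))) Γ [Δ] := ⟨[Δ], [], rfl, g1, rfl, e⟩
  obtain ⟨φ, ψ, a1, a2, a3⟩ := Real.pair _ Γ Δ this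
  refine Γ.diam_mono a3 ?_
  have hd := hR ψ a2
  exact Γ.diam_guard a1 hd

end Paths
end XPathMinus

namespace XPathMinus

section Extend
variable [Fintype A]

/-- Prime families of path expressions based at `Γ`. -/
structure PrimeAt (Γ : MCS A) (F : PathExpr A → Prop) : Prop where
  mono : ∀ {α β}, PLe α β → F α → F β
  union : ∀ {α β}, F (.union α β) → F α ∨ F β
  diam : ∀ {α}, F α → Γ.car (.diam α)

theorem PrimeAt.guard {Γ : MCS A} {F : PathExpr A → Prop} (hF : PrimeAt Γ F) {φ : NodeExpr A}
    {α : PathExpr A} (h : Γ.car φ) (h' : F α) : F (.comp (.test φ) α) := by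
  have e : PDer α (.union (.comp (.test φ) α) (.comp (.test (.neg φ)) α)) :=
    (((PDer.isAx5l α).symm).trans (.congr_comp (test_em φ).symm (.refl α))).trans (.isAx6r _ _ _)
  rcases hF.union (hF.mono (PLe.of_eq e) h') with h1 | h1
  · exact h1
  · exact absurd h ((Γ.neg φ).1 (Γ.diam_guard_left (hF.diam h1)))

theorem PrimeAt.right {Γ : MCS A} {F : PathExpr A → Prop} (hF : PrimeAt Γ F) (γ : PathExpr A) :
    PrimeAt Γ (fun α => F (.comp α γ)) where
  mono h h1 := hF.mono (h.comp (PLe.refl γ)) h1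
  union h := hF.union (hF.mono (PLe.of_eq (.isAx6r _ _ _)) h)
  diam h := Γ.diam_comp_left (hF.diam h)

theorem PrimeAt.left {Γ : MCS A} {F : PathExpr A → Prop} (hF : PrimeAt Γ F) (p : List (MCS A))
    (hp : ∃ α, Real α Γ p) :
    PrimeAt (lastM Γ p) (fun β => ∀ α, Real α Γ p → F (.comp α β)) where
  mono h h1 α ha := hF.mono ((PLe.refl α).comp h) (h1 α ha)
  union {β β'} h := by
    by_contra hc
    push Not at hc
    obtain ⟨⟨α, h1, h2⟩, α', h3, h4⟩ := hc
    obtain ⟨γ, g1, g2, g3⟩ := Real.refine p Γ α α' h1 h3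
    rcases hF.union (hF.mono (PLe.of_eq (.isAx6l _ _ _)) (h γ g1)) with h5 | h5
    · exact h2 (hF.mono (g2.comp (PLe.refl _)) h5)
    · exact h4 (hF.mono (g3.comp (PLe.refl _)) h5)
  diam {β} h := by
    by_contra hc
    obtain ⟨α, ha⟩ := hp
    have := h (.comp α (.test (.neg (.diam β))))
      ⟨p, [], by simp, ha, rfl, ((lastM Γ p).neg _).2 hc⟩
    exact Γ.not_bot (hF.diam (hF.mono (PLe.of_eq (.prAx1 α β)) this))

theorem PrimeAt.nil {Γ : MCS A} {F : PathExpr A → Prop} (hF : PrimeAt Γ F) (h : F .eps) :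
    ∀ α, Real α Γ [] → F α := by
  intro α ha
  obtain ⟨φ, h1, h2⟩ := Real.single α Γ ha
  exact hF.mono ((PLe.of_eq (PDer.isAx5r _)).trans h2) (hF.guard h1 h)

theorem extend : ∀ (α : PathExpr A) (Γ : MCS A) (F : PathExpr A → Prop), PrimeAt Γ F → F α →
    ∃ p, Chn Γ p ∧ Real α Γ p ∧ ∀ α', Real α' Γ p → F α'
  | .eps, Γ, F, hF, h => ⟨[], trivial, rfl, hF.nil h⟩
  | .test φ, Γ, F, hF, h =>
    ⟨[], trivial, ⟨rfl, (Γ.diam_test φ).1 (hF.diam h)⟩, hF.nil (hF.mono (PLe.test_eps φ) h)⟩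
  | .union α β, Γ, F, hF, h => by
    rcases hF.union h with h | h
    · obtain ⟨p, h1, h2, h3⟩ := extend α Γ F hF h
      exact ⟨p, h1, Or.inl h2, h3⟩
    · obtain ⟨p, h1, h2, h3⟩ := extend β Γ F hF h
      exact ⟨p, h1, Or.inr h2, h3⟩
  | .comp α β, Γ, F, hF, h => by
    obtain ⟨p, h1, h2, h3⟩ := extend α Γ _ (hF.right β) h
    obtain ⟨q, k1, k2, k3⟩ := extend β (lastM Γ p) _ (hF.left p ⟨α, h2⟩) h3
    refine ⟨p ++ q, h1.append k1, ⟨p, q, rfl, h2, k2⟩, ?_⟩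
    intro γ hγ
    obtain ⟨γ1, γ2, g1, g2, g3⟩ := Real.factor γ Γ p q hγ
    exact hF.mono g3 (k3 γ2 g2 γ1 g1)
  | .down, Γ, F, hF, h => by
    have htest : ∀ {φ ψ : NodeExpr A}, NDer φ ψ → PLe (.comp .down (.test φ))
        (.comp .down (.test ψ)) := fun h => PLe.of_eq (.congr_comp (.refl _) (.congr_test h))
    have hor : ∀ φ ψ : NodeExpr A, PDer (.comp .down (.test (nOr φ ψ)))
        (.union (.comp .down (.test φ)) (.comp .down (.test ψ))) := fun φ ψ =>
      (PDer.congr_comp (.refl _) (.prAx3 φ ψ)).trans (.isAx6l _ _ _)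
    obtain ⟨Δ, hΔ⟩ := exists_mcs (fun φ => ¬ F (.comp .down (.test φ)))
      (fun h h1 h2 => h1 (hF.mono (htest h.symm) h2))
      (fun {φ ψ} h1 h2 => h1 (hF.mono ((PLe.inl _ _).trans (PLe.of_eq (hor φ ψ).symm)) h2))
      (fun {φ ψ} h1 h2 h3 => (hF.union (hF.mono (PLe.of_eq (hor φ ψ)) h3)).elim h1 h2)
      (fun h1 => by
        have := hF.diam h1
        have := (Γ.resp (.ndAx4 .down botP)).1 this
        have e : PDer (.comp .down (.test (.diam botP)) : PathExpr A) botP := by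
          refine PDer.trans ?_ (PDer.prAx1 .down .eps)
          exact (PDer.congr_comp (.refl _) (.congr_test (.ndAx2 _))).trans (PDer.isAx5r _).symm
        exact Γ.not_bot ((Γ.resp (.congr_diam e)).1 this))
      (fun h1 => h1 (hF.mono (PLe.of_eq ((PDer.isAx5r _).symm.trans
        (.congr_comp (.refl _) PDer.prAx2.symm))) h))
    simp only [not_not] at hΔ
    refine ⟨[Δ], ⟨fun φ hφ => hF.diam (hΔ φ hφ), trivial⟩, ⟨Δ, rfl⟩, ?_⟩
    intro α ha
    obtain ⟨φ, ψ, h1, h2, h3⟩ := Real.pair α Γ Δ ha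
    exact hF.mono h3 (hF.guard h1 (hΔ ψ h2))

theorem extend_eq {Γ : MCS A} {α β : PathExpr A} (h : Γ.car (.eqTest α β)) :
    ∃ p q, Chn Γ p ∧ Chn Γ q ∧ Real α Γ p ∧ Real β Γ q ∧ EqM Γ p q := by
  have hF : PrimeAt Γ (fun α' => Γ.car (.eqTest α' β)) :=
    { mono := fun h h1 => Γ.eq_monoL h h1
      union := fun h => (Γ.or _ _).1 ((Γ.resp (.eqAx2 _ _ _)).1 h)
      diam := fun h => Γ.le (.eqAx4 _ _) h }
  obtain ⟨p, h1, h2, h3⟩ := extend α Γ _ hF h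
  have hG : PrimeAt Γ (fun β' => ∀ α', Real α' Γ p → Γ.car (.eqTest α' β')) :=
    { mono := fun h h1 α' ha => Γ.eq_mono (PLe.refl _) h (h1 α' ha)
      union := by
        intro β1 β2 h
        by_contra hc
        push Not at hc
        obtain ⟨⟨α, h1, h2⟩, α', h3, h4⟩ := hc
        obtain ⟨γ, g1, g2, g3⟩ := Real.refine p Γ α α' h1 h3
        rcases (Γ.or _ _).1 ((Γ.resp (.eqAx2 _ _ _)).1 (Γ.eq_symm (h γ g1))) with h5 | h5
        · exact h2 (Γ.eq_monoL g2 (Γ.eq_symm h5))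
        · exact h4 (Γ.eq_monoL g3 (Γ.eq_symm h5))
      diam := fun h => Γ.le (.eqAx4 _ _) (Γ.eq_symm (h α h2)) }
  obtain ⟨q, k1, k2, k3⟩ := extend β Γ _ hG h3
  exact ⟨p, q, h1, k1, h2, k2, fun α' β' ha hb => k3 β' hb α' ha⟩

theorem separate {α β : PathExpr A} (h : ¬ PLe α β) :
    ∃ (Γ : MCS A) (p : List (MCS A)), Chn Γ p ∧ Real α Γ p ∧ ¬ Real β Γ p := by
  have hor : ∀ (φ ψ : NodeExpr A) (γ : PathExpr A), PDer (.comp (.test (nOr φ ψ)) γ)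
      (.union (.comp (.test φ) γ) (.comp (.test ψ) γ)) := fun φ ψ γ =>
    (PDer.congr_comp (.prAx3 φ ψ) (.refl _)).trans (.isAx6r _ _ _)
  obtain ⟨Γ, hΓ⟩ := exists_mcs (fun φ => PLe (.comp (.test φ) α) β)
    (fun h h1 => (PLe.of_eq (.congr_comp (.congr_test h.symm) (.refl _))).trans h1)
    (fun h1 => ((PLe.inl _ _).trans (PLe.of_eq (hor _ _ _).symm)).trans h1)
    (fun h1 h2 => (PLe.of_eq (hor _ _ _)).trans (h1.union_le h2))
    (by
      refine PLe.trans (PLe.of_eq ?_) (PLe.bot β)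
      have h1 : PDer (.comp botP α) (.comp botP (.comp .eps α) : PathExpr A) :=
        .congr_comp (.refl _) (PDer.isAx5l α).symm
      have h2 : PLe (.comp botP α) (.comp (.test (.neg (.diam α))) α : PathExpr A) := by
        refine PLe.comp ?_ (PLe.refl α)
        have := nOr_bot (A := A) (.neg (.diam α))
        exact (PDer.prAx3 _ _).symm.trans (.congr_test this)
      have h3 : PDer (.comp (.test (.neg (.diam α))) α) (botP : PathExpr A) :=
        (PDer.congr_comp (PDer.isAx5l _).symm (.refl _)).trans (PDer.prAx1 .eps α)
      exact PLe.antisymm (h2.trans (PLe.of_eq h3)) (PLe.bot _))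
    (fun h1 => h (PLe.trans (PLe.of_eq ((PDer.isAx5l α).symm.trans
      (.congr_comp PDer.prAx2.symm (.refl _)))) h1))
  have hF : PrimeAt Γ (fun γ => ∀ φ, Γ.car φ → ¬ PLe (.comp (.test φ) γ) β) :=
    { mono := fun h h1 φ hφ h2 => h1 φ hφ (((PLe.refl _).comp h).trans h2)
      union := by
        intro γ γ' h
        by_contra hc
        push Not at hc
        obtain ⟨⟨φ, h1, h2⟩, φ', h3, h4⟩ := hc
        obtain ⟨χ, c1, c2⟩ := Real.single (.comp (.test φ) (.test φ')) Γ
          ⟨[], [], rfl, ⟨rfl, h1⟩, rfl, h3⟩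
        refine h χ c1 ((PLe.of_eq (.isAx6l _ _ _)).trans (PLe.union_le ?_ ?_))
        · exact ((c2.trans (PLe.testR _ _)).comp (PLe.refl _)).trans h2
        · exact ((c2.trans (PLe.testL _ _)).comp (PLe.refl _)).trans h4
      diam := by
        intro γ h
        by_contra hc
        refine h _ ((Γ.neg _).2 hc) (PLe.trans (PLe.of_eq ?_) (PLe.bot β))
        exact (PDer.congr_comp (PDer.isAx5l _).symm (.refl _)).trans (PDer.prAx1 .eps γ) }
  obtain ⟨p, h1, h2, h3⟩ := extend α Γ _ hF hΓ
  exact ⟨Γ, p, h1, h2, fun hb => h3 β hb topN Γ.top (PLe.testL _ _)⟩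

end Extend
end XPathMinus

namespace XPathMinus

section Tree
variable [Fintype A]

/-- Nodes of the canonical tree. -/
inductive Nd (A : Type) [Fintype A] : Type
  | root : MCS A → Nd A
  | plain : Nd A → MCS A → Nd A
  | glue : Nd A → MCS A → List (MCS A) → List (MCS A) → List (MCS A) → Nd A
  | cont : Nd A → MCS A → List (MCS A) → Nd A

/-- Data values: private values of nodes, and values shared by a glued pair. -/
inductive Vl (A : Type) [Fintype A] : Type
  | own : Nd A → Vl A
  | tag : Nd A → List (MCS A) → List (MCS A) → Vl A

/-- The node at which a value is created. -/
def Vl.base : Vl A → Nd A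
  | .own x => x
  | .tag x _ _ => x

namespace Nd

/-- The maximal consistent set of a node. -/
def ty : Nd A → MCS A
  | root Γ => Γ
  | plain _ Δ => Δ
  | glue _ Δ _ _ _ => Δ
  | cont _ Δ _ => Δ

/-- The parent of a node. -/
def par : Nd A → Option (Nd A)
  | root _ => none
  | plain x _ => some x
  | glue x _ _ _ _ => some x
  | cont x _ _ => some x

/-- The depth of a node. -/
def dep : Nd A → ℕ
  | root _ => 0
  | plain x _ => dep x + 1
  | glue x _ _ _ _ => dep x + 1
  | cont x _ _ => dep x + 1

/-- Value of a node from its pending information. -/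
def valOf (x : Nd A) : Option (List (MCS A) × Vl A) → Vl A
  | some ([], v) => v
  | _ => .own x

/-- Value transmitted by a gluing. -/
def gval (x : Nd A) (v : Vl A) : List (MCS A) → List (MCS A) → Vl A
  | a :: p, b :: q => .tag x (a :: p) (b :: q)
  | _, _ => v

/-- Pending path and value of a node. -/
def pend : Nd A → Option (List (MCS A) × Vl A)
  | root _ => none
  | plain _ _ => none
  | glue x _ l p q => some (l, gval x (valOf x (pend x)) p q)
  | cont x _ l => (pend x).map fun s => (l, s.2)

/-- The data value of a node. -/
def val (x : Nd A) : Vl A := valOf x (pend x)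

/-- Legal nodes. -/
def Valid (Γ : MCS A) : Nd A → Prop
  | root Γ' => Γ' = Γ
  | plain x Δ => Valid Γ x ∧ Acc1 x.ty Δ
  | glue x Δ l p q => Valid Γ x ∧ Acc1 x.ty Δ ∧ EqM x.ty p q ∧ (Δ :: l = p ∨ Δ :: l = q)
  | cont x Δ l => Valid Γ x ∧ Acc1 x.ty Δ ∧ ∃ v, x.pend = some (Δ :: l, v)

/-- Ancestor-or-self relation. -/
inductive Anc : Nd A → Nd A → Prop
  | refl (x) : Anc x x
  | step {x y z} : Anc x y → par z = some y → Anc x z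

theorem dep_par {x y : Nd A} (h : par y = some x) : dep y = dep x + 1 := by
  cases y <;> simp_all [par, dep]

theorem Anc.dep_le {x y : Nd A} (h : Anc x y) : dep x ≤ dep y := by
  induction h with
  | refl => exact le_rfl
  | step _ h ih => rw [dep_par h]; omega

theorem Anc.trans {x y z : Nd A} (h : Anc x y) (h' : Anc y z) : Anc x z := by
  induction h' with
  | refl => exact h
  | step _ h2 ih => exact .step ih h2

theorem Anc.of_par {x y z : Nd A} (h : par y = some x) (h' : Anc y z) : Anc x z :=
  (Anc.step (.refl x) h).trans h'

theorem Anc.unique {x y z : Nd A} (h : Anc x z) (h' : Anc y z) (hd : dep x = dep y) : x = y := by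
  induction h generalizing y with
  | refl =>
    cases h' with
    | refl => rfl
    | step h1 h2 => have := h1.dep_le; have := dep_par h2; omega
  | step h1 h2 ih =>
    cases h' with
    | refl => have := h1.dep_le; have := dep_par h2; omega
    | step h3 h4 =>
      rw [h2] at h4
      cases h4
      exact ih h3 hd

theorem valid_par {Γ : MCS A} {x y : Nd A} (h : par y = some x) (hy : Valid Γ y) :
    Valid Γ x ∧ Acc1 x.ty y.ty := by
  cases y with
  | root => simp [par] at h
  | plain z Δ => cases h; exact hy
  | glue z Δ l p q => cases h; exact ⟨hy.1, hy.2.1⟩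
  | cont z Δ l => cases h; exact ⟨hy.1, hy.2.1⟩

theorem gval_cases (x : Nd A) (v : Vl A) (p q : List (MCS A)) :
    ((p = [] ∨ q = []) ∧ gval x v p q = v) ∨ (gval x v p q = .tag x p q) := by
  cases p <;> cases q <;> simp [gval]

theorem val_cases (x : Nd A) : (∃ v, pend x = some ([], v) ∧ val x = v) ∨
    ((∀ v, pend x ≠ some ([], v)) ∧ val x = .own x) := by
  unfold val
  rcases h : pend x with _ | ⟨l, v⟩
  · right; simp [valOf]
  · cases l <;> simp [valOf]

/-- Pending values are created at strict ancestors. -/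
theorem pend_base : ∀ {x : Nd A} {r v}, pend x = some (r, v) →
    Anc v.base x ∧ dep v.base < dep x
  | root _, r, v, h => by simp [pend] at h
  | plain _ _, r, v, h => by simp [pend] at h
  | cont x Δ l, r, v, h => by
    rcases hx : pend x with _ | ⟨l', v'⟩
    · simp [pend, hx] at h
    · simp only [pend, hx, Option.map_some, Option.some.injEq, Prod.mk.injEq] at h
      obtain ⟨rfl, rfl⟩ := h
      have := pend_base hx
      exact ⟨.step this.1 rfl, by simp only [dep]; omega⟩
  | glue x Δ l p q, r, v, h => by
    simp only [pend, Option.some.injEq, Prod.mk.injEq] at h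
    obtain ⟨rfl, h⟩ := h
    have hv : Anc (val x).base x ∧ dep (val x).base ≤ dep x := by
      rcases val_cases x with ⟨v, h1, h2⟩ | ⟨h1, h2⟩
      · have := pend_base h1
        rw [h2]; exact ⟨this.1, this.2.le⟩
      · rw [h2]; exact ⟨.refl x, le_rfl⟩
    change gval x (val x) p q = v at h
    rcases gval_cases x (val x) p q with ⟨_, h3⟩ | h3
    · rw [h3] at h; subst h
      exact ⟨.step hv.1 rfl, by simp only [dep]; omega⟩
    · rw [h3] at h; subst h
      exact ⟨.step (.refl x) rfl, by simp [dep, Vl.base]⟩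

theorem val_base (x : Nd A) : Anc (val x).base x := by
  rcases val_cases x with ⟨v, h1, h2⟩ | ⟨h1, h2⟩
  · rw [h2]; exact (pend_base h1).1
  · rw [h2]; exact .refl x

theorem val_ne_tag (x : Nd A) (p q : List (MCS A)) : val x ≠ .tag x p q := by
  rcases val_cases x with ⟨v, h1, h2⟩ | ⟨h1, h2⟩
  · rw [h2]; rintro rfl
    exact absurd (pend_base h1).2 (lt_irrefl _)
  · rw [h2]; simp

/-- Descending paths in the tree with their types. -/
inductive Pth (Γ : MCS A) : Nd A → List (MCS A) → Nd A → Prop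
  | nil {x} : Valid Γ x → Pth Γ x [] x
  | cons {x y z l} : par y = some x → Valid Γ y → Pth Γ y l z → Pth Γ x (y.ty :: l) z

variable {Γ : MCS A}

theorem Pth.anc {x z : Nd A} {l} (h : Pth Γ x l z) : Anc x z := by
  induction h with
  | nil => exact .refl _
  | cons h _ _ ih => exact .of_par h ih

theorem Pth.dep {x z : Nd A} {l} (h : Pth Γ x l z) : dep z = dep x + l.length := by
  induction h with
  | nil => rfl
  | cons h _ _ ih => rw [ih, dep_par h, List.length_cons]; omega

theorem Pth.valid {x z : Nd A} {l} (h : Pth Γ x l z) : Valid Γ x ∧ Valid Γ z := by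
  induction h with
  | nil h => exact ⟨h, h⟩
  | cons h h1 _ ih => exact ⟨(valid_par h h1).1, ih.2⟩

theorem Pth.last {x z : Nd A} {l} (h : Pth Γ x l z) : lastM x.ty l = z.ty := by
  induction h with
  | nil h => rfl
  | cons h h1 _ ih => exact ih

theorem Pth.append {x y z : Nd A} {l l'} (h : Pth Γ x l y) (h' : Pth Γ y l' z) :
    Pth Γ x (l ++ l') z := by
  induction h with
  | nil => exact h'
  | cons h h1 _ ih => exact .cons h h1 (ih h')

theorem Pth.split {x z : Nd A} : ∀ {l l'}, Pth Γ x (l ++ l') z → ∃ y, Pth Γ x l y ∧ Pth Γ y l' z := by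
  intro l
  induction l generalizing x with
  | nil => intro l' h; exact ⟨x, .nil h.valid.1, h⟩
  | cons Δ l ih =>
    intro l' h
    cases h with
    | cons h1 h2 h3 =>
      obtain ⟨y, h4, h5⟩ := ih h3
      exact ⟨y, .cons h1 h2 h4, h5⟩

theorem Pth.nil_eq {x z : Nd A} (h : Pth Γ x [] z) : x = z := by
  cases h; rfl

theorem Pth.unique {x z : Nd A} {l l'} (h : Pth Γ x l z) (h' : Pth Γ x l' z) : l = l' := by
  induction h generalizing l' with
  | nil =>
    have := h'.dep
    exact (List.length_eq_zero_iff.1 (by omega)).symm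
  | cons h1 h2 h3 ih =>
    cases h' with
    | nil => have := h3.dep; have := dep_par h1; omega
    | cons h4 h5 h6 =>
      have e := h3.anc.unique h6.anc (by rw [dep_par h1, dep_par h4])
      subst e
      rw [ih h6]

/-- A value seen below `y` is created below `y`, or escapes through the unique pending path. -/
theorem escape {y w : Nd A} {p} (h : Pth Γ y p w) : Anc y (val w).base ∨
    ∃ r s, p = r ++ s ∧ pend y = some (r, val w) ∧ EqM (lastM y.ty r) [] s := by
  induction h with
  | @nil x h =>
    rcases val_cases x with ⟨v, h1, h2⟩ | ⟨h1, h2⟩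
    · right; rw [h2]; exact ⟨[], [], rfl, h1, EqM.nil _⟩
    · left; rw [h2]; exact .refl x
  | @cons y z w p hz hv hp ih =>
    rcases ih with ih | ⟨r, s, rfl, h1, h2⟩
    · exact Or.inl (.of_par hz ih)
    · cases z with
      | root => simp [par] at hz
      | plain => simp [pend] at h1
      | glue x Δ l p0 q0 =>
        cases hz
        simp only [pend, Option.some.injEq, Prod.mk.injEq] at h1
        obtain ⟨rfl, h1⟩ := h1
        change gval y (val y) p0 q0 = _ at h1
        rcases gval_cases y (val y) p0 q0 with ⟨h3, h4⟩ | h4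
        · rw [h4] at h1
          have e : EqM y.ty [] (Δ :: l) := by
            obtain ⟨_, _, e1, e2⟩ := hv
            rcases h3 with rfl | rfl
            · rcases e2 with e2 | e2
              · cases e2
              · rw [e2]; exact e1
            · rcases e2 with e2 | e2
              · rw [e2]; exact e1.symm
              · cases e2
          rcases val_cases y with ⟨v, h5, h6⟩ | ⟨h5, h6⟩
          · right
            refine ⟨[], _, rfl, ?_, e.appendR h2⟩
            rw [h5, ← h1, h6]
          · left; rw [← h1, h6]; exact .refl y
        · left; rw [← h1, h4]; exact .refl y
      | cont x Δ l =>
        cases hz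
        right
        obtain ⟨_, _, v, hv⟩ := hv
        simp only [pend, hv, Option.map_some, Option.some.injEq, Prod.mk.injEq] at h1
        obtain ⟨rfl, rfl⟩ := h1
        exact ⟨Δ :: l, s, rfl, hv, h2⟩

/-- Shape of a child whose pending path is defined. -/
theorem child_pend {x y : Nd A} (hy : par y = some x) (hv : Valid Γ y) {r v}
    (h : pend y = some (r, v)) :
    (EqM x.ty [] (y.ty :: r) ∧ v = val x) ∨
    (∃ p q, y = .glue x y.ty r p q ∧ EqM x.ty p q ∧ (y.ty :: r = p ∨ y.ty :: r = q) ∧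
      v = .tag x p q) ∨
    (y = .cont x y.ty r ∧ pend x = some (y.ty :: r, v)) := by
  cases y with
  | root => simp [par] at hy
  | plain => simp [pend] at h
  | glue x' Δ l p q =>
    cases hy
    simp only [pend, Option.some.injEq, Prod.mk.injEq] at h
    obtain ⟨rfl, h⟩ := h
    change gval x (val x) p q = _ at h
    obtain ⟨_, _, e1, e2⟩ := hv
    rcases gval_cases x (val x) p q with ⟨h3, h4⟩ | h4
    · left
      refine ⟨?_, by rw [← h, h4]⟩
      change EqM x.ty [] (Δ :: l)
      rcases h3 with rfl | rfl
      · rcases e2 with e2 | e2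
        · cases e2
        · rw [e2]; exact e1
      · rcases e2 with e2 | e2
        · rw [e2]; exact e1.symm
        · cases e2
    · right; left
      exact ⟨p, q, rfl, e1, e2, by rw [← h, h4]⟩
  | cont x' Δ l =>
    cases hy
    obtain ⟨_, _, v', hv⟩ := hv
    simp only [pend, hv, Option.map_some, Option.some.injEq, Prod.mk.injEq] at h
    obtain ⟨rfl, rfl⟩ := h
    exact Or.inr (Or.inr ⟨rfl, hv⟩)

theorem val_ne_pend {x : Nd A} {Δ r v} (h : pend x = some (Δ :: r, v)) : val x ≠ v := by
  rcases val_cases x with ⟨v', h1, h2⟩ | ⟨h1, h2⟩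
  · rw [h] at h1; cases h1
  · rw [h2]; rintro rfl
    exact absurd (pend_base h).2 (lt_irrefl _)

theorem key_nil {x y w : Nd A} {p} (hy : par y = some x) (hv : Valid Γ y) (h : Pth Γ y p w)
    (e : val w = val x) : EqM x.ty [] (y.ty :: p) := by
  rcases escape h with h1 | ⟨r, s, rfl, h1, h2⟩
  · rw [e] at h1
    have := h1.dep_le
    have := (val_base x).dep_le
    have := dep_par hy
    omega
  · rcases child_pend hy hv h1 with ⟨h3, h4⟩ | ⟨p, q, h3, h4, h5, h6⟩ | ⟨h3, h4⟩
    · exact h3.appendR (q := y.ty :: r) h2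
    · rw [e] at h6; exact absurd h6 (val_ne_tag _ _ _)
    · rw [e] at h4; exact absurd rfl (val_ne_pend h4)

theorem key {x w w' : Nd A} {p q} (h : Pth Γ x p w) (h' : Pth Γ x q w') (e : val w = val w') :
    EqM x.ty p q := by
  induction h generalizing q with
  | nil =>
    cases h' with
    | nil => exact EqM.nil _
    | cons h1 h2 h3 => exact key_nil h1 h2 h3 e.symm
  | @cons x y w p h1 h2 h3 ih =>
    cases h' with
    | nil => exact (key_nil h1 h2 h3 e).symm
    | @cons _ y' _ q k1 k2 k3 =>
      by_cases hyy : y = y'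
      · subst hyy
        exact EqM.lift (valid_par h1 h2).2 (ih k3 e)
      have hd : Nd.dep y = Nd.dep y' := by rw [dep_par h1, dep_par k1]
      rcases escape h3 with a1 | ⟨r, s, rfl, a1, a2⟩
      · rw [e] at a1
        exact absurd ((a1.trans (val_base w')).unique k3.anc hd) hyy
      rcases escape k3 with b1 | ⟨r', s', rfl, b1, b2⟩
      · rw [← e] at b1
        exact absurd (h3.anc.unique (b1.trans (val_base w)) hd) hyy
      rw [← e] at b1
      suffices hs : EqM x.ty (y.ty :: r) (y'.ty :: r') from
        EqM.append (p := y.ty :: r) (q := y'.ty :: r') hs a2 b2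
      rcases child_pend h1 h2 a1 with ⟨c3, c4⟩ | ⟨p0, q0, c3, c4, c5, c6⟩ | ⟨c3, c4⟩
      · rcases child_pend k1 k2 b1 with ⟨d3, d4⟩ | ⟨p1, q1, d3, d4, d5, d6⟩ | ⟨d3, d4⟩
        · exact c3.ax7 d3
        · rw [c4] at d6; exact absurd d6 (val_ne_tag _ _ _)
        · rw [c4] at d4; exact absurd rfl (val_ne_pend d4)
      · rcases child_pend k1 k2 b1 with ⟨d3, d4⟩ | ⟨p1, q1, d3, d4, d5, d6⟩ | ⟨d3, d4⟩
        · rw [d4] at c6; exact absurd c6 (val_ne_tag _ _ _)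
        · rw [c6] at d6
          cases d6
          have hne : y.ty :: r ≠ y'.ty :: r' := by
            intro hc
            obtain ⟨hc1, hc2⟩ := List.cons.inj hc
            rw [hc1, hc2] at c3
            exact hyy (c3.trans d3.symm)
          rcases c5 with c5 | c5 <;> rcases d5 with d5 | d5
          · exact absurd (c5.trans d5.symm) hne
          · rw [c5, d5]; exact c4
          · rw [c5, d5]; exact c4.symm
          · exact absurd (c5.trans d5.symm) hne
        · rw [c6] at d4
          exact absurd (pend_base d4).2 (lt_irrefl _)
      · rcases child_pend k1 k2 b1 with ⟨d3, d4⟩ | ⟨p1, q1, d3, d4, d5, d6⟩ | ⟨d3, d4⟩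
        · rw [d4] at c4; exact absurd rfl (val_ne_pend c4)
        · rw [d6] at c4
          exact absurd (pend_base c4).2 (lt_irrefl _)
        · rw [c4] at d4
          simp only [Option.some.injEq, Prod.mk.injEq, List.cons.injEq, and_true] at d4
          rw [d4.1, d4.2] at c3
          exact absurd (c3.trans d3.symm) hyy

theorem exists_cont : ∀ (l : List (MCS A)) (y : Nd A) (v), Valid Γ y → pend y = some (l, v) →
    Chn y.ty l → ∃ z, Pth Γ y l z ∧ val z = v
  | [], y, v, hy, hp, _ => ⟨y, .nil hy, by simp [val, hp, valOf]⟩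
  | Δ :: l, y, v, hy, hp, hc => by
    have hv : Valid Γ (.cont y Δ l) := ⟨hy, hc.1, v, hp⟩
    obtain ⟨z, h1, h2⟩ := exists_cont l (.cont y Δ l) v hv (by simp [pend, hp]) hc.2
    exact ⟨z, .cons (y := .cont y Δ l) rfl hv h1, h2⟩

theorem exists_glue {x : Nd A} (hx : Valid Γ x) {p q : List (MCS A)} (he : EqM x.ty p q)
    {Δ l} (hs : Δ :: l = p ∨ Δ :: l = q) (hc : Chn x.ty (Δ :: l)) :
    ∃ z, Pth Γ x (Δ :: l) z ∧ val z = gval x (val x) p q := by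
  have hv : Valid Γ (.glue x Δ l p q) := ⟨hx, hc.1, he, hs⟩
  obtain ⟨z, h1, h2⟩ := exists_cont l (.glue x Δ l p q) _ hv rfl hc.2
  exact ⟨z, .cons (y := .glue x Δ l p q) rfl hv h1, h2⟩

theorem exists_pair {x : Nd A} (hx : Valid Γ x) {p q : List (MCS A)} (he : EqM x.ty p q)
    (hp : Chn x.ty p) (hq : Chn x.ty q) :
    ∃ y z, Pth Γ x p y ∧ Pth Γ x q z ∧ val y = val z := by
  rcases p with _ | ⟨Δ, l⟩
  · rcases q with _ | ⟨Δ', l'⟩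
    · exact ⟨x, x, .nil hx, .nil hx, rfl⟩
    · obtain ⟨z, h1, h2⟩ := exists_glue hx he (Or.inr rfl) hq
      exact ⟨x, z, .nil hx, h1, h2.symm⟩
  · rcases q with _ | ⟨Δ', l'⟩
    · obtain ⟨z, h1, h2⟩ := exists_glue hx he (Or.inl rfl) hp
      exact ⟨z, x, h1, .nil hx, h2⟩
    · obtain ⟨y, h1, h2⟩ := exists_glue hx he (Or.inl rfl) hp
      obtain ⟨z, h3, h4⟩ := exists_glue hx he (Or.inr rfl) hq
      exact ⟨y, z, h1, h3, h2.trans h4.symm⟩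

theorem exists_plain : ∀ (l : List (MCS A)) (x : Nd A), Valid Γ x → Chn x.ty l → ∃ z, Pth Γ x l z
  | [], x, hx, _ => ⟨x, .nil hx⟩
  | Δ :: l, x, hx, hc => by
    have hv : Valid Γ (.plain x Δ) := ⟨hx, hc.1⟩
    obtain ⟨z, h⟩ := exists_plain l (.plain x Δ) hv hc.2
    exact ⟨z, .cons (y := .plain x Δ) rfl hv h⟩

end Nd

theorem MCS.bigOr (M : MCS A) (l : List (NodeExpr A)) (h : M.car (XPathMinus.bigOr l)) :
    ∃ φ ∈ l, M.car φ := by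
  induction l with
  | nil => exact absurd M.top ((M.neg _).1 h)
  | cons φ l ih =>
    rcases (M.or φ (XPathMinus.bigOr l)).1 h with h | h
    · exact ⟨φ, by simp, h⟩
    · obtain ⟨ψ, h1, h2⟩ := ih h
      exact ⟨ψ, by simp [h1], h2⟩

theorem MCS.exists_lab (M : MCS A) : ∃ a, M.car (.lab a) := by
  obtain ⟨φ, h1, h2⟩ := M.bigOr _ ((M.resp .lbAx1).1 M.top)
  obtain ⟨a, _, rfl⟩ := List.mem_map.1 h1
  exact ⟨a, h2⟩

/-- The label of a maximal consistent set. -/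
noncomputable def MCS.lab (M : MCS A) : A := M.exists_lab.choose

theorem MCS.lab_iff (M : MCS A) (a : A) : M.lab = a ↔ M.car (.lab a) := by
  have h0 : M.car (.lab M.lab) := M.exists_lab.choose_spec
  constructor
  · rintro rfl; exact h0
  · intro h
    by_contra hne
    exact (M.neg _).1 ((M.resp (.lbAx2 hne)).2 ((M.conj _ _).2 ⟨h0, h⟩)) M.top

theorem canon_reach (Γ : MCS A) : ∀ (x : Nd A) (hx : x.Valid Γ),
    Relation.ReflTransGen (fun x y : {x : Nd A // x.Valid Γ} => y.1.par = some x.1)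
      ⟨.root Γ, rfl⟩ ⟨x, hx⟩
  | .root _, hx => by cases hx; exact .refl
  | .plain x Δ, hx => (canon_reach Γ x hx.1).tail rfl
  | .glue x Δ l p q, hx => (canon_reach Γ x hx.1).tail rfl
  | .cont x Δ l, hx => (canon_reach Γ x hx.1).tail rfl

/-- The canonical data tree. -/
noncomputable def canon (Γ : MCS A) : DataTree A where
  X := {x : Nd A // x.Valid Γ}
  child x y := y.1.par = some x.1
  root := ⟨.root Γ, rfl⟩
  label x := x.1.ty.lab
  eqd x y := x.1.val = y.1.val
  eqd_equiv := ⟨fun _ => rfl, fun h => h.symm, fun h h' => h.trans h'⟩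
  parent_unique := by
    intro x y z h1 h2
    rw [h1] at h2
    exact Subtype.ext (Option.some.inj h2)
  root_no_parent := by
    intro x h
    cases h
  reach := fun x => canon_reach Γ x.1 x.2
  acyclic := by
    intro x h
    have : ∀ y, Relation.TransGen
        (fun x y : {x : Nd A // x.Valid Γ} => y.1.par = some x.1) x y → x.1.dep < y.1.dep := by
      intro y h
      induction h with
      | single h => rw [Nd.dep_par h]; omega
      | tail _ h ih => rw [Nd.dep_par h]; omega
    exact lt_irrefl _ (this x h)

mutual
theorem ptruth (Γ : MCS A) : ∀ (α : PathExpr A) (x y : (canon Γ).X),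
    psem (canon Γ) α x y ↔ ∃ p, Nd.Pth Γ x.1 p y.1 ∧ Real α x.1.ty p
  | .eps, x, y => by
    simp only [psem, Real]
    constructor
    · rintro rfl; exact ⟨[], .nil x.2, rfl⟩
    · rintro ⟨p, h, rfl⟩
      exact Subtype.ext h.nil_eq
  | .down, x, y => by
    simp only [psem, Real]
    constructor
    · intro h; exact ⟨[y.1.ty], .cons h y.2 (.nil y.2), _, rfl⟩
    · rintro ⟨p, h, Δ, rfl⟩
      cases h with
      | cons h1 h2 h3 => cases h3; exact h1
  | .test φ, x, y => by
    simp only [psem, Real, ntruth Γ φ x]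
    constructor
    · rintro ⟨rfl, h⟩; exact ⟨[], .nil x.2, rfl, h⟩
    · rintro ⟨p, h, rfl, h'⟩
      exact ⟨Subtype.ext h.nil_eq, h'⟩
  | .union α β, x, y => by
    simp only [psem, Real, ptruth Γ α x y, ptruth Γ β x y, and_or_left, exists_or]
  | .comp α β, x, z => by
    simp only [psem, Real]
    constructor
    · rintro ⟨y, h1, h2⟩
      obtain ⟨p, h3, h4⟩ := (ptruth Γ α x y).1 h1
      obtain ⟨q, h5, h6⟩ := (ptruth Γ β y z).1 h2
      refine ⟨p ++ q, h3.append h5, p, q, rfl, h4, ?_⟩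
      rwa [h3.last]
    · rintro ⟨_, h, p, q, rfl, h4, h6⟩
      obtain ⟨y, h3, h5⟩ := h.split
      rw [h3.last] at h6
      exact ⟨⟨y, h3.valid.2⟩, (ptruth Γ α x ⟨y, h3.valid.2⟩).2 ⟨p, h3, h4⟩,
        (ptruth Γ β ⟨y, h3.valid.2⟩ z).2 ⟨q, h5, h6⟩⟩

theorem ntruth (Γ : MCS A) : ∀ (φ : NodeExpr A) (x : (canon Γ).X),
    nsem (canon Γ) φ x ↔ x.1.ty.car φ
  | .lab a, x => by simp only [nsem]; exact x.1.ty.lab_iff a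
  | .neg φ, x => by simp only [nsem, MCS.neg, ntruth Γ φ x]
  | .conj φ ψ, x => by simp only [nsem, MCS.conj, ntruth Γ φ x, ntruth Γ ψ x]
  | .diam α, x => by
    rw [← x.1.ty.resp (.eqAx6 α)]
    simp only [nsem]
    constructor
    · rintro ⟨y, h⟩
      obtain ⟨p, h1, h2⟩ := (ptruth Γ α x y).1 h
      exact Nd.key h1 h1 rfl α α h2 h2
    · intro h
      obtain ⟨p, q, h1, _, h2, _, _⟩ := extend_eq h
      obtain ⟨y, h3⟩ := Nd.exists_plain p x.1 x.2 h1
      exact ⟨⟨y, h3.valid.2⟩, (ptruth Γ α x ⟨y, h3.valid.2⟩).2 ⟨p, h3, h2⟩⟩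
  | .eqTest α β, x => by
    simp only [nsem]
    constructor
    · rintro ⟨y, z, h, h', e⟩
      obtain ⟨p, h1, h2⟩ := (ptruth Γ α x y).1 h
      obtain ⟨q, h3, h4⟩ := (ptruth Γ β x z).1 h'
      exact Nd.key h1 h3 e α β h2 h4
    · intro h
      obtain ⟨p, q, h1, h2, h3, h4, h5⟩ := extend_eq h
      obtain ⟨y, z, h6, h7, h8⟩ := Nd.exists_pair x.2 h5 h1 h2
      exact ⟨⟨y, h6.valid.2⟩, ⟨z, h7.valid.2⟩,
        (ptruth Γ α x ⟨y, h6.valid.2⟩).2 ⟨p, h6, h3⟩,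
        (ptruth Γ β x ⟨z, h7.valid.2⟩).2 ⟨q, h7, h4⟩, h8⟩
end

theorem complete_le {α β : PathExpr A}
    (h : ∀ (T : DataTree A) (x y : T.X), psem T α x y → psem T β x y) : PLe α β := by
  by_contra hc
  obtain ⟨Γ, p, h1, h2, h3⟩ := separate hc
  obtain ⟨y, h4⟩ := Nd.exists_plain (Γ := Γ) p (.root Γ) rfl h1
  have h5 := (ptruth Γ α ⟨.root Γ, rfl⟩ ⟨y, h4.valid.2⟩).2 ⟨p, h4, h2⟩
  obtain ⟨q, h6, h7⟩ := (ptruth Γ β _ _).1 (h _ _ _ h5)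
  have := h4.unique h6
  subst this
  exact h3 h7

theorem pcomplete {α β : PathExpr A} (h : pathValid α β) : PDer α β :=
  PLe.antisymm (complete_le fun T x y => (h T x y).1) (complete_le fun T x y => (h T x y).2)

theorem ncomplete {φ ψ : NodeExpr A} (h : nodeValid φ ψ) : NDer φ ψ :=
  toN (pcomplete fun T x y => by simp only [psem]; rw [h T x])

end Tree
end XPathMinus

/-- Completeness (and soundness) of `XP⁻` for `XPath↓⁻`: a node (resp. path)
equivalence is derivable iff it is semantically valid. -/
theorem XPathMinus.completeness {A : Type} [Fintype A] (hA : 1 < Fintype.card A) :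
    (∀ φ ψ : NodeExpr A, NDer φ ψ ↔ nodeValid φ ψ) ∧
    (∀ α β : PathExpr A, PDer α β ↔ pathValid α β) := by
  exact ⟨fun φ ψ => ⟨nsound, ncomplete⟩, fun α β => ⟨psound, pcomplete⟩⟩
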